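/- Let n ≥ 1 and r ≥ 1 be natural numbers with n ≥ 2r−2. Then the probability that a random lattice path of length n has exactly r zeros, namely P(Z_n = r) = (1/(n+1)) · Σ_{ℓ=0}^{n} (number of lattice paths of length n starting at height n−2ℓ with exactly r zeros)/C(n,ℓ), is equal to (2^r/(n+1)) · (C(⌈n/2⌉, r)/C(n,r)) · ( 2⌈n/2⌉/(r(r+1)) + (r−1)/(r+1) + [n even]/r ) + [n even] · (2^{r−1}(r−1)/((n+1)·r)) · (C(n/2, r−1)/C(n,r)). -/

import Mathlib

/-- The height after `i` steps of the walk starting at height `s` whose `j`-th step is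
`+1` if `σ j = true` and `−1` if `σ j = false`. -/
def walk {n : ℕ} (s : ℤ) (σ : Fin n → Bool) (i : ℕ) : ℤ :=
  s + ∑ j : Fin n, if (j : ℕ) < i then (if σ j then 1 else -1) else 0

/-- The lattice paths of length `n` starting at height `s` (and ending at height `0`),
encoded by their step sequences. -/
def paths (n : ℕ) (s : ℤ) : Finset (Fin n → Bool) :=
  Finset.univ.filter (fun σ => walk s σ n = 0)

/-- number of paths with exactly r zeros, recursively -/
def NN : ℕ → ℤ → ℕ → ℕ
  | 0, s, r => if s = 0 ∧ r = 1 then 1 else 0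
  | n + 1, s, r =>
      if s = 0 then (if r = 0 then 0 else NN n 1 (r-1) + NN n (-1) (r-1))
      else NN n (s + 1) r + NN n (s - 1) r

def NC (n : ℕ) (s : ℤ) (r : ℕ) : ℕ :=
  ((paths n s).filter (fun σ =>
              ((Finset.range (n + 1)).filter
                (fun i => walk s σ i = 0)).card = r)).card

lemma walk_zero {n : ℕ} (s : ℤ) (σ : Fin n → Bool) : walk s σ 0 = s := by
  simp [walk]

lemma walk_cons {n : ℕ} (s : ℤ) (b : Bool) (σ : Fin n → Bool) (i : ℕ) :
    walk s (Fin.cons b σ : Fin (n+1) → Bool) (i + 1) = walk (s + if b then 1 else -1) σ i := by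
  simp [walk, Fin.sum_univ_succ, add_assoc]

lemma zeros_cons {n : ℕ} (s : ℤ) (b : Bool) (σ : Fin n → Bool) :
    ((Finset.range (n + 1 + 1)).filter
      (fun i => walk s (Fin.cons b σ : Fin (n+1) → Bool) i = 0)).card =
    ((Finset.range (n + 1)).filter
      (fun i => walk (s + if b then 1 else -1) σ i = 0)).card + if s = 0 then 1 else 0 := by
  rw [Finset.card_filter, Finset.sum_range_succ', Finset.card_filter]
  simp only [walk_cons, walk_zero]

lemma NC_eq_sum (n : ℕ) (s : ℤ) (r : ℕ) : NC n s r = ∑ σ : Fin n → Bool,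
    if walk s σ n = 0 ∧ ((Finset.range (n + 1)).filter (fun i => walk s σ i = 0)).card = r
      then 1 else 0 := by
  rw [NC, paths, Finset.filter_filter, Finset.card_filter]

lemma NC_succ (n : ℕ) (s : ℤ) (r : ℕ) : NC (n+1) s r =
    if s = 0 then (if r = 0 then 0 else NC n 1 (r-1) + NC n (-1) (r-1))
      else NC n (s + 1) r + NC n (s - 1) r := by
  rw [NC_eq_sum, ← (Fin.consEquiv (fun _ : Fin (n+1) => Bool)).sum_comp, Fintype.sum_prod_type,
    Fintype.sum_bool]
  have key : ∀ b : Bool, ∀ τ : Fin n → Bool,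
      (Fin.consEquiv (fun _ : Fin (n+1) => Bool)) (b, τ) = (Fin.cons b τ : Fin (n+1) → Bool) :=
    fun _ _ => rfl
  have key2 : ∀ b : Bool, ∀ τ : Fin n → Bool, ((Finset.range (n + 1 + 1)).filter
      (fun i => walk s ((Fin.consEquiv (fun _ : Fin (n+1) => Bool)) (b, τ)) i = 0)).card =
    ((Finset.range (n + 1)).filter
      (fun i => walk (s + if b then 1 else -1) τ i = 0)).card + if s = 0 then 1 else 0 :=
    fun b τ => zeros_cons s b τ
  simp only [key2]
  simp only [key, walk_cons]
  by_cases hs : s = 0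
  · subst hs
    cases r with
    | zero => simp
    | succ r => simp [NC_eq_sum]
  · simp [hs, NC_eq_sum, sub_eq_add_neg]

lemma NC_eq (n : ℕ) : ∀ (s : ℤ) (r : ℕ), NC n s r = NN n s r := by
  induction n with
  | zero =>
    intro s r
    rw [NC_eq_sum, NN]
    simp only [walk, Finset.univ_eq_empty, Finset.sum_empty, add_zero]
    by_cases hs : s = 0
    · simp [hs, eq_comm]
    · simp [hs]
  | succ n ih =>
    intro s r
    rw [NC_succ, NN]
    simp only [ih]

lemma NN_neg (n : ℕ) : ∀ (s : ℤ) (r : ℕ), NN n (-s) r = NN n s r := by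
  induction n with
  | zero => intro s r; simp [NN]
  | succ n ih =>
    intro s r
    rw [NN, NN]
    by_cases hs : s = 0
    · simp [hs]
    · simp only [neg_eq_zero, hs, if_false]
      rw [← ih (-s+1), ← ih (-s-1), add_comm]
      congr 2 <;> ring

lemma NN_r0 (n : ℕ) : ∀ (s : ℤ), NN n s 0 = 0 := by
  induction n with
  | zero => intro s; simp [NN]
  | succ n ih => intro s; simp [NN, ih]

lemma NN_small (n : ℕ) : ∀ (s q : ℕ), n < s + 2 * q → NN n s (q+1) = 0 := by
  induction n with
  | zero =>
    intro s q h
    simp only [NN]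
    rw [if_neg]
    omega
  | succ n ih =>
    intro s q h
    rw [NN]
    cases s with
    | zero =>
      cases q with
      | zero => omega
      | succ q =>
        have := ih 1 q (by omega)
        simp only [Nat.cast_one] at this
        simp [NN_neg, this]
    | succ s =>
      rw [if_neg (by omega)]
      have h1 := ih (s+2) q (by omega)
      have h2 := ih s q (by omega)
      push_cast at *
      rw [add_sub_cancel_right, h2, add_assoc]
      norm_num
      exact h1

def BB (h : ℕ) : ℕ → ℤ
  | 0 => 1
  | k + 1 => ((h + 2 * k + 1).choose (k+1) : ℤ) - (h + 2 * k + 1).choose k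

lemma BB_zero (k : ℕ) : BB 0 (k+1) = 0 := by
  rw [BB, ← Nat.choose_symm_of_eq_add (a := k+1) (b := k) (by ring)]
  simp

lemma BB_succ (h k : ℕ) : BB (h+1) (k+1) = BB h (k+1) + BB (h+2) k := by
  cases k with
  | zero => simp [BB]
  | succ k =>
    simp only [BB]
    have e1 : h + 1 + 2 * (k + 1) + 1 = (h + 2 * (k+1) + 1) + 1 := by ring
    have e2 : h + 2 + 2 * k + 1 = h + 2 * (k+1) + 1 := by ring
    rw [e1, e2, Nat.choose_succ_succ (h + 2 * (k + 1) + 1) (k+1),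
      Nat.choose_succ_succ (h + 2 * (k + 1) + 1) k]
    simp only [Nat.succ_eq_add_one]
    push_cast
    ring

lemma BB_closed (h k : ℕ) : ((h + 2 * k : ℕ) : ℤ) * BB h k = h * (h + 2 * k).choose k := by
  cases k with
  | zero => simp [BB]
  | succ k =>
    simp only [BB]
    have h1 := Nat.choose_succ_right_eq (h + 2 * k + 1) k
    have e : h + 2 * k + 1 - k = h + k + 1 := by omega
    rw [e] at h1
    rw [show h + 2 * (k+1) = (h + 2 * k + 1) + 1 by ring, Nat.choose_succ_succ (h + 2 * k + 1) k]
    zify at h1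
    push_cast
    simp only [Nat.succ_eq_add_one] at *
    generalize ((h + 2 * k + 1).choose (k+1) : ℤ) = x at *
    generalize ((h + 2 * k + 1).choose k : ℤ) = y at *
    linear_combination 2 * h1

lemma NN_BB (n : ℕ) : ∀ (s k q : ℕ), n = s + 2 * k + 2 * q →
    (NN n s (q+1) : ℤ) = 2 ^ q * BB (s + q) k := by
  induction n with
  | zero =>
    intro s k q h
    obtain rfl : s = 0 := by omega
    obtain rfl : k = 0 := by omega
    obtain rfl : q = 0 := by omega
    simp [NN, BB]
  | succ n ih =>
    intro s k q h
    rw [NN]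
    cases s with
    | zero =>
      cases q with
      | zero =>
        obtain ⟨k, rfl⟩ : ∃ k', k = k' + 1 := ⟨k-1, by omega⟩
        simp [NN_r0, BB_zero]
      | succ q =>
        have := ih 1 k q (by omega)
        simp only [Nat.cast_one] at this
        simp only [Nat.cast_zero, if_true, NN_neg, Nat.add_sub_cancel]
        rw [if_neg (by omega)]
        push_cast
        rw [this, show 0 + (q+1) = 1 + q by ring]
        ring
    | succ s =>
      rw [if_neg (by omega)]
      have h2 := ih s k q (by omega)
      rw [show ((s+1 : ℕ) : ℤ) - 1 = s by push_cast; ring,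
        show ((s+1 : ℕ) : ℤ) + 1 = (s+2 : ℕ) by push_cast; ring]
      push_cast at h2 ⊢
      rw [h2]
      cases k with
      | zero =>
        have h1 := NN_small n (s+2) q (by omega)
        push_cast at h1
        rw [h1]
        simp [BB]
      | succ k =>
        have h1 := ih (s+2) k q (by omega)
        push_cast at h1
        rw [h1, show s + 1 + q = s + q + 1 by ring, BB_succ, show s + 2 + q = s + q + 2 by ring]
        ring

lemma NN_term (n l q : ℕ) (hn : 1 ≤ n) (hl : 2 * l ≤ n) (hq : q + 1 ≤ n) :
    (NN n ((n:ℤ) - 2 * l) (q+1) : ℚ) / n.choose l =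
      2 ^ q * ((n:ℚ) - 2 * l + q) * l.choose q / ((q+1) * n.choose (q+1)) := by
  obtain ⟨s, rfl⟩ : ∃ s, n = s + 2 * l := ⟨n - 2 * l, by omega⟩
  have es : ((s + 2 * l : ℕ) : ℤ) - 2 * l = (s : ℕ) := by push_cast; ring
  rw [es]
  have hc1 : ((s + 2 * l).choose l : ℚ) ≠ 0 := by
    exact_mod_cast (Nat.choose_pos (by omega)).ne'
  have hc2 : ((s + 2 * l).choose (q+1) : ℚ) ≠ 0 := by
    exact_mod_cast (Nat.choose_pos (by omega)).ne'
  rcases lt_or_ge l q with h | h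
  · rw [NN_small _ _ _ (by omega), Nat.choose_eq_zero_of_lt h]; simp
  · obtain ⟨k, rfl⟩ : ∃ k, l = k + q := ⟨l - q, by omega⟩
    have h1 := NN_BB (s + 2 * (k+q)) s k q (by ring)
    have h2 := BB_closed (s+q) k
    have h3 := Nat.choose_mul (n := s + 2 * (k+q)) (k := k+q) (s := q) (by omega) 
    have h4 := Nat.choose_succ_right_eq (s + 2 * (k+q)) q
    rw [show s + 2 * (k+q) - q = s + q + 2 * k by omega] at h3 h4
    rw [show k + q - q = k by omega] at h3
    rw [div_eq_div_iff hc1 (mul_ne_zero (by positivity) hc2)]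
    qify at h1 h2 h3 h4
    rw [h1]
    push_cast at *
    linear_combination 2^q * (BB (s+q) k : ℚ) * h4 + 2^q * ((s + 2 * (k+q)).choose q : ℚ) * h2
      - 2^q * (s + q:ℚ) * h3

lemma sum_half (n q m : ℕ) : ∑ l ∈ Finset.range m, ((n:ℚ) - 2 * l + q) * l.choose q =
    (n + q + 2) * m.choose (q+1) - 2 * (q+1) * (m+1).choose (q+2) := by
  induction m with
  | zero => simp [Nat.choose_eq_zero_of_lt (show 1 < q + 2 by omega)]
  | succ m ih =>
    rw [Finset.sum_range_succ, ih, Nat.choose_succ_succ (m+1) (q+1), Nat.choose_succ_succ m q]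
    have h1 := Nat.add_one_mul_choose_eq m q
    rw [Nat.choose_succ_succ] at h1
    qify at h1
    push_cast
    linear_combination (-2) * h1

/-- Exact distribution of the number of zeros: for `n ≥ 1`, `r ≥ 1`, `n ≥ 2r−2`,
`P(Z_n = r) = (2^r/(n+1))·(C(⌈n/2⌉,r)/C(n,r))·(2⌈n/2⌉/(r(r+1)) + (r−1)/(r+1) + [n even]/r)
  + [n even]·(2^{r−1}(r−1)/((n+1)r))·(C(n/2,r−1)/C(n,r))`. -/
theorem distribution_of_zeros (n r : ℕ) (hn : 1 ≤ n) (hr : 1 ≤ r) (hnr : 2 * r - 2 ≤ n) :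
    (1 / ((n : ℚ) + 1)) *
        ∑ l ∈ Finset.range (n + 1),
          ((((paths n ((n : ℤ) - 2 * l)).filter (fun σ =>
              ((Finset.range (n + 1)).filter
                (fun i => walk ((n : ℤ) - 2 * l) σ i = 0)).card = r)).card : ℚ)
            / (n.choose l : ℚ))
      = ((2 : ℚ) ^ r / ((n : ℚ) + 1)) * ((((n + 1) / 2).choose r : ℚ) / (n.choose r : ℚ)) *
          (2 * (((n + 1) / 2 : ℕ) : ℚ) / ((r : ℚ) * ((r : ℚ) + 1))
            + ((r : ℚ) - 1) / ((r : ℚ) + 1)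
            + (if Even n then 1 / (r : ℚ) else 0))
        + (if Even n then
            ((2 : ℚ) ^ (r - 1) * ((r : ℚ) - 1) / (((n : ℚ) + 1) * (r : ℚ))) *
              (((n / 2).choose (r - 1) : ℚ) / (n.choose r : ℚ))
          else 0) := by
  have hr1 : r ≤ n := by omega
  obtain ⟨q, rfl⟩ : ∃ q, r = q + 1 := ⟨r - 1, by omega⟩
  change (1 / ((n : ℚ) + 1)) * ∑ l ∈ Finset.range (n + 1),
    ((NC n ((n : ℤ) - 2 * l) (q+1) : ℚ) / (n.choose l : ℚ)) = _
  simp only [NC_eq]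
  set t : ℕ → ℚ := fun l => (NN n ((n : ℤ) - 2 * l) (q+1) : ℚ) / (n.choose l : ℚ) with ht
  have hsym : ∀ l, l ≤ n → t (n - l) = t l := by
    intro l hl
    simp only [ht]
    rw [Nat.choose_symm hl, ← NN_neg]
    congr 3
    push_cast [hl]
    ring
  have hterm : ∀ l, 2 * l ≤ n → t l = 2 ^ q / ((q+1) * n.choose (q+1)) *
      (((n:ℚ) - 2 * l + q) * l.choose q) := by
    intro l hl
    simp only [ht]
    rw [NN_term n l q hn hl hr1]
    ring
  have hhalf : ∀ m, 2 * m ≤ n + 1 → ∑ l ∈ Finset.range m, t l =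
      2 ^ q / ((q+1) * n.choose (q+1)) *
      ((n + q + 2) * m.choose (q+1) - 2 * (q+1) * (m+1).choose (q+2)) := by
    intro m hm
    rw [← sum_half, Finset.mul_sum]
    apply Finset.sum_congr rfl
    intro l hl
    have := Finset.mem_range.mp hl
    exact hterm l (by omega)
  have hc2 : (n.choose (q+1) : ℚ) ≠ 0 := by
    exact_mod_cast (Nat.choose_pos (by omega)).ne'
  have hn1 : (n : ℚ) + 1 ≠ 0 := by positivity
  have hq1 : (q : ℚ) + 1 ≠ 0 := by positivity
  have hq2 : (q : ℚ) + 2 ≠ 0 := by positivity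
  have hupper : ∀ a m, a + m = n + 1 → ∑ i ∈ Finset.range m, t (a + i) =
      ∑ l ∈ Finset.range m, t l := by
    intro a m h
    rw [← Finset.sum_range_reflect (fun i => t i)]
    apply Finset.sum_congr rfl
    intro i hi
    have := Finset.mem_range.mp hi
    rw [← hsym (m - 1 - i) (by omega)]
    congr 1
    omega
  have hch : ∀ m : ℕ, ((m+1).choose (q+2) : ℚ) = (m+1) * m.choose (q+1) / (q+2) := by
    intro m
    have h1 := Nat.add_one_mul_choose_eq m (q+1)
    qify at h1
    rw [eq_div_iff hq2, h1]
    ring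
  have hq2' : (q : ℚ) + 1 + 1 ≠ 0 := by positivity
  rcases Nat.even_or_odd' n with ⟨m, hm | hm⟩
  · have he : Even n := ⟨m, by omega⟩
    have e1 : (n + 1) / 2 = m := by omega
    have e2 : n / 2 = m := by omega
    have hS : ∑ l ∈ Finset.range (n+1), t l = 2 * ∑ l ∈ Finset.range m, t l + t m := by
      rw [show n + 1 = (m + 1) + m by omega, Finset.sum_range_add, hupper (m+1) m (by omega),
        Finset.sum_range_succ]
      ring
    rw [hS, hhalf m (by omega), hterm m (by omega), if_pos he, if_pos he, e1, e2, hch]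
    have hmq : (n : ℚ) = 2 * m := by exact_mod_cast hm
    simp only [Nat.add_sub_cancel]
    push_cast
    generalize (n.choose (q+1) : ℚ) = x at *
    generalize (m.choose (q+1) : ℚ) = y at *
    generalize (m.choose q : ℚ) = z at *
    rw [hmq] at *
    field_simp
    ring
  · have he : ¬ Even n := by rw [Nat.not_even_iff_odd]; exact ⟨m, hm⟩
    have e1 : (n + 1) / 2 = m + 1 := by omega
    have hS : ∑ l ∈ Finset.range (n+1), t l = 2 * ∑ l ∈ Finset.range (m+1), t l := by
      rw [show n + 1 = (m + 1) + (m + 1) by omega, Finset.sum_range_add,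
        hupper (m+1) (m+1) (by omega)]
      ring
    rw [hS, hhalf (m+1) (by omega), if_neg he, if_neg he, e1, hch]
    have hmq : (n : ℚ) = 2 * m + 1 := by exact_mod_cast hm
    push_cast
    generalize (n.choose (q+1) : ℚ) = x at *
    generalize ((m+1).choose (q+1) : ℚ) = y at *
    rw [hmq] at *
    field_simp
    ring
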